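/- Let f be a continuous real function on an interval I ⊆ ℝ with 0 ∈ I. Then f is operator convex on I and f(0) ≤ 0 if and only if for some (equivalently, every) natural number n, the inequality f(Σ_{k=1}^n a_k* x_k a_k) ≤ Σ_{k=1}^n a_k* f(x_k) a_k holds for every n-tuple (x_1, …, x_n) of bounded self-adjoint operators on a complex Hilbert space H with spectra contained in I and every n-tuple (a_1, …, a_n) of bounded operators on H with Σ_{k=1}^n a_k* a_k ≤ 1. -/

import Mathlib

/-- A continuous real function `f` on an interval `I ⊆ ℝ` is *operator convex on `I`* if
`f(λx + (1−λ)y) ≤ λ f(x) + (1−λ) f(y)` in the Loewner order, for every `λ ∈ [0,1]` and every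
pair of bounded self-adjoint operators `x, y` on an infinite-dimensional complex Hilbert space
with spectra contained in `I`; here `f(x)` is given by the continuous functional calculus. -/
def OperatorConvexOn (f : ℝ → ℝ) (I : Set ℝ) : Prop :=
  ∀ (H : Type) [NormedAddCommGroup H] [InnerProductSpace ℂ H] [CompleteSpace H],
    ¬ FiniteDimensional ℂ H →
      ∀ x y : H →L[ℂ] H, IsSelfAdjoint x → IsSelfAdjoint y →
        spectrum ℝ x ⊆ I → spectrum ℝ y ⊆ I →
          ∀ t : ℝ, t ∈ Set.Icc (0 : ℝ) 1 →
            cfc f (t • x + (1 - t) • y) ≤ t • cfc f x + (1 - t) • cfc f y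

/-- Jensen's operator inequality for contractive `n`-tuples: for every `n`-tuple
`(x₁, …, xₙ)` of bounded self-adjoint operators on a complex Hilbert space `H` with spectra
in `I` and every `n`-tuple `(a₁, …, aₙ)` of operators on `H` with `∑ aₖ* aₖ ≤ 1`, one has
`f(∑ aₖ* xₖ aₖ) ≤ ∑ aₖ* f(xₖ) aₖ`. -/
def JensenContractiveIneq (f : ℝ → ℝ) (I : Set ℝ) (n : ℕ) : Prop :=
  ∀ (H : Type) [NormedAddCommGroup H] [InnerProductSpace ℂ H] [CompleteSpace H],
    ∀ x a : Fin n → H →L[ℂ] H, (∀ k, IsSelfAdjoint (x k)) →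
      (∀ k, spectrum ℝ (x k) ⊆ I) → ∑ k, star (a k) * a k ≤ 1 →
        cfc f (∑ k, star (a k) * x k * a k) ≤ ∑ k, star (a k) * cfc f (x k) * a k

section Jensen

open ContinuousLinearMap
open scoped InnerProduct InnerProductSpace

variable {H L : Type*} [NormedAddCommGroup H] [InnerProductSpace ℂ H] [CompleteSpace H]
  [NormedAddCommGroup L] [InnerProductSpace ℂ L] [CompleteSpace L]

/-- A compact subset of an order-connected set containing `0` lies in an interval `[m, M]` of that
set which contains `0`. -/
theorem exists_subset_Icc_of_isCompact {I S : Set ℝ} (hI : I.OrdConnected) (h0 : (0 : ℝ) ∈ I)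
    (hS : IsCompact S) (hSI : S ⊆ I) :
    ∃ m M : ℝ, m ≤ 0 ∧ 0 ≤ M ∧ Set.Icc m M ⊆ I ∧ S ⊆ Set.Icc m M := by
  have hc : IsCompact (insert 0 S) := hS.insert 0
  have hsub : insert 0 S ⊆ I := Set.insert_subset h0 hSI
  obtain ⟨m, hm⟩ := hc.exists_isLeast ⟨0, Set.mem_insert 0 S⟩
  obtain ⟨M, hM⟩ := hc.exists_isGreatest ⟨0, Set.mem_insert 0 S⟩
  exact ⟨m, M, hm.2 (Set.mem_insert 0 S), hM.2 (Set.mem_insert 0 S),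
    hI.out (hsub hm.1) (hsub hM.1), fun s hs =>
      ⟨hm.2 (Set.mem_insert_of_mem _ hs), hM.2 (Set.mem_insert_of_mem _ hs)⟩⟩

theorem IsSelfAdjoint.spectrum_subset_Icc_iff {x : H →L[ℂ] H} (hx : IsSelfAdjoint x) {m M : ℝ} :
    spectrum ℝ x ⊆ Set.Icc m M ↔ m • (1 : H →L[ℂ] H) ≤ x ∧ x ≤ M • (1 : H →L[ℂ] H) := by
  rw [← Algebra.algebraMap_eq_smul_one, ← Algebra.algebraMap_eq_smul_one,
    algebraMap_le_iff_le_spectrum hx, le_algebraMap_iff_spectrum_le hx]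
  exact ⟨fun h => ⟨fun s hs => (h hs).1, fun s hs => (h hs).2⟩,
    fun h s hs => ⟨h.1 s hs, h.2 s hs⟩⟩

theorem adjoint_conj_mono {x y : H →L[ℂ] H} (h : x ≤ y) (a : L →L[ℂ] H) :
    a† ∘L x ∘L a ≤ a† ∘L y ∘L a := by
  rw [ContinuousLinearMap.le_def] at h ⊢
  convert h.adjoint_conj a using 1
  ext v
  simp

theorem isSelfAdjoint_sum_adjoint_conj {n : ℕ} {x : Fin n → H →L[ℂ] H}
    (a : Fin n → L →L[ℂ] H) (hx : ∀ k, IsSelfAdjoint (x k)) :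
    IsSelfAdjoint (∑ k, (a k)† ∘L x k ∘L a k) :=
  isSelfAdjoint_sum _ fun k _ => (hx k).adjoint_conj (a k)

theorem spectrum_sum_adjoint_conj_subset {I : Set ℝ} (hI : I.OrdConnected) (h0 : (0 : ℝ) ∈ I)
    {n : ℕ} {x : Fin n → H →L[ℂ] H} {a : Fin n → L →L[ℂ] H} (hx : ∀ k, IsSelfAdjoint (x k))
    (hxI : ∀ k, spectrum ℝ (x k) ⊆ I) (ha : ∑ k, (a k)† ∘L a k ≤ 1) :
    spectrum ℝ (∑ k, (a k)† ∘L x k ∘L a k) ⊆ I := by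
  obtain ⟨m, M, hm, hM, hmM, hsub⟩ := exists_subset_Icc_of_isCompact hI h0
    (isCompact_iUnion fun k => spectrum.isCompact (𝕜 := ℝ) (x k)) (Set.iUnion_subset hxI)
  have hb k := (hx k).spectrum_subset_Icc_iff.1 ((Set.subset_iUnion _ k).trans hsub)
  have key (c : ℝ) : ∑ k, (a k)† ∘L (c • (1 : H →L[ℂ] H)) ∘L a k
      = c • ∑ k, (a k)† ∘L a k := by
    ext v
    simp [Finset.smul_sum]
  have h1 : 0 ≤ 1 - ∑ k, (a k)† ∘L a k := sub_nonneg.2 ha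
  refine Set.Subset.trans ?_ hmM
  refine (isSelfAdjoint_sum_adjoint_conj a hx).spectrum_subset_Icc_iff.2 ⟨?_, ?_⟩
  · refine le_trans ?_ (Finset.sum_le_sum fun k _ => adjoint_conj_mono (hb k).1 (a k))
    rw [key, ← sub_nonneg]
    have := smul_nonneg (neg_nonneg.2 hm) h1
    rwa [neg_smul, ← smul_neg, neg_sub, smul_sub] at this
  · refine le_trans (Finset.sum_le_sum fun k _ => adjoint_conj_mono (hb k).2 (a k)) ?_
    rw [key, ← sub_nonneg, ← smul_sub]
    exact smul_nonneg hM h1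

theorem spectrum_adjoint_conj_subset {I : Set ℝ} (hI : I.OrdConnected) (h0 : (0 : ℝ) ∈ I)
    {x : H →L[ℂ] H} {a : L →L[ℂ] H} (hx : IsSelfAdjoint x)
    (hxI : spectrum ℝ x ⊆ I) (ha : a† ∘L a ≤ 1) :
    spectrum ℝ (a† ∘L x ∘L a) ⊆ I := by
  simpa using spectrum_sum_adjoint_conj_subset hI h0 (n := 1) (x := fun _ => x)
    (a := fun _ => a) (fun _ => hx) (fun _ => hxI) (by simpa using ha)

theorem spectrum_convexCombination_subset {I : Set ℝ} (hI : I.OrdConnected) (h0 : (0 : ℝ) ∈ I)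
    {x y : H →L[ℂ] H} (hx : IsSelfAdjoint x) (hy : IsSelfAdjoint y)
    (hxI : spectrum ℝ x ⊆ I) (hyI : spectrum ℝ y ⊆ I) {t : ℝ} (ht : t ∈ Set.Icc (0 : ℝ) 1) :
    spectrum ℝ (t • x + (1 - t) • y) ⊆ I := by
  obtain ⟨m, M, hm, hM, hmM, hsub⟩ := exists_subset_Icc_of_isCompact hI h0
    ((spectrum.isCompact (𝕜 := ℝ) x).union (spectrum.isCompact (𝕜 := ℝ) y))
    (Set.union_subset hxI hyI)
  obtain ⟨hx1, hx2⟩ := hx.spectrum_subset_Icc_iff.1 (Set.subset_union_left.trans hsub)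
  obtain ⟨hy1, hy2⟩ := hy.spectrum_subset_Icc_iff.1 (Set.subset_union_right.trans hsub)
  have ht' : 0 ≤ 1 - t := sub_nonneg.2 ht.2
  have key (c : ℝ) : t • c • (1 : H →L[ℂ] H) + (1 - t) • c • 1 = c • 1 := by
    rw [← add_smul, add_sub_cancel, one_smul]
  refine Set.Subset.trans ?_ hmM
  refine (((IsSelfAdjoint.all t).smul hx).add
    ((IsSelfAdjoint.all (1 - t)).smul hy)).spectrum_subset_Icc_iff.2 ⟨?_, ?_⟩
  · rw [← key]
    exact add_le_add (smul_le_smul_of_nonneg_left hx1 ht.1) (smul_le_smul_of_nonneg_left hy1 ht')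
  · rw [← key M]
    exact add_le_add (smul_le_smul_of_nonneg_left hx2 ht.1) (smul_le_smul_of_nonneg_left hy2 ht')

/-- An operator intertwining two self-adjoint operators intertwines their polynomials. -/
theorem aeval_comp_eq_comp_aeval {H L : Type*} [NormedAddCommGroup H] [InnerProductSpace ℂ H]
    [NormedAddCommGroup L] [InnerProductSpace ℂ L] {x : H →L[ℂ] H} {X : L →L[ℂ] L} {V : H →L[ℂ] L}
    (h : X ∘L V = V ∘L x) (p : Polynomial ℝ) :
    (Polynomial.aeval X p) ∘L V = V ∘L (Polynomial.aeval x p) := by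
  induction p using Polynomial.induction_on with
  | C c =>
    ext v
    simp [Algebra.algebraMap_eq_smul_one]
  | add p q hp hq => simp [add_comp, comp_add, hp, hq]
  | monomial n c ih =>
    rw [pow_succ, ← mul_assoc, map_mul, map_mul (Polynomial.aeval x), Polynomial.aeval_X,
      Polynomial.aeval_X, mul_def, mul_def, comp_assoc, h, ← comp_assoc, ih, comp_assoc]

theorem norm_cfc_sub_aeval_le {f : ℝ → ℝ} {x : H →L[ℂ] H} (hf : ContinuousOn f (spectrum ℝ x))
    (hx : IsSelfAdjoint x) {δ : ℝ} (hδ : 0 ≤ δ) {p : Polynomial ℝ}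
    (hp : ∀ s ∈ spectrum ℝ x, |p.eval s - f s| ≤ δ) :
    ‖cfc f x - Polynomial.aeval x p‖ ≤ δ := by
  rw [← cfc_polynomial p x hx, ← cfc_sub f p.eval x hf p.continuous.continuousOn]
  refine norm_cfc_le hδ fun s hs => ?_
  rw [Real.norm_eq_abs, abs_sub_comm]
  exact hp s hs

theorem cfc_comp_eq_comp_cfc {f : ℝ → ℝ} {I : Set ℝ} (hI : I.OrdConnected)
    (hf : ContinuousOn f I) (h0 : (0 : ℝ) ∈ I) {x : H →L[ℂ] H} {X : L →L[ℂ] L}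
    {V : H →L[ℂ] L} (hx : IsSelfAdjoint x) (hX : IsSelfAdjoint X)
    (hxI : spectrum ℝ x ⊆ I) (hXI : spectrum ℝ X ⊆ I) (h : X ∘L V = V ∘L x) :
    cfc f X ∘L V = V ∘L cfc f x := by
  obtain ⟨m, M, hm, hM, hmM, hsub⟩ := exists_subset_Icc_of_isCompact hI h0
    ((spectrum.isCompact (𝕜 := ℝ) x).union (spectrum.isCompact (𝕜 := ℝ) X))
    (Set.union_subset hxI hXI)
  rw [← sub_eq_zero, ← norm_le_zero_iff]
  refine le_of_forall_pos_le_add fun ε hε => ?_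
  have hV : 0 ≤ ‖V‖ := norm_nonneg V
  set δ : ℝ := ε / (2 * (‖V‖ + 1)) with hδ
  have hδ0 : 0 < δ := by positivity
  obtain ⟨p, hp⟩ := exists_polynomial_near_of_continuousOn m M f (hf.mono hmM) δ hδ0
  have h1 := norm_cfc_sub_aeval_le (hf.mono hxI) hx hδ0.le fun s hs =>
    (hp s (hsub (Set.mem_union_left _ hs))).le
  have h2 := norm_cfc_sub_aeval_le (hf.mono hXI) hX hδ0.le fun s hs =>
    (hp s (hsub (Set.mem_union_right _ hs))).le
  have e : cfc f X ∘L V - V ∘L cfc f x = (cfc f X - Polynomial.aeval X p) ∘L V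
      - V ∘L (cfc f x - Polynomial.aeval x p) := by
    rw [sub_comp, comp_sub, aeval_comp_eq_comp_aeval h]
    abel
  rw [e, zero_add]
  calc _ ≤ ‖(cfc f X - Polynomial.aeval X p) ∘L V‖ + ‖V ∘L (cfc f x - Polynomial.aeval x p)‖ :=
        norm_sub_le _ _
    _ ≤ δ * ‖V‖ + ‖V‖ * δ := by
        refine add_le_add ((opNorm_comp_le _ _).trans ?_) ((opNorm_comp_le _ _).trans ?_) <;> gcongr
    _ ≤ ε := by
        have : δ * (2 * (‖V‖ + 1)) = ε := by rw [hδ]; field_simp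
        nlinarith

/-- Jensen's operator inequality for an isometry into an infinite-dimensional space. -/
theorem OperatorConvexOn.cfc_adjoint_conj_le {H L : Type} [NormedAddCommGroup H]
    [InnerProductSpace ℂ H] [CompleteSpace H] [NormedAddCommGroup L] [InnerProductSpace ℂ L]
    [CompleteSpace L] {f : ℝ → ℝ} {I : Set ℝ} (hc : OperatorConvexOn f I)
    (hI : I.OrdConnected) (hf : ContinuousOn f I) (h0 : (0 : ℝ) ∈ I)
    (hL : ¬ FiniteDimensional ℂ L) {Y : L →L[ℂ] L} {V : H →L[ℂ] L} (hV : V† ∘L V = 1)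
    (hY : IsSelfAdjoint Y) (hYI : spectrum ℝ Y ⊆ I) :
    cfc f (V† ∘L Y ∘L V) ≤ V† ∘L cfc f Y ∘L V := by
  have hV' (v : H) : (V†) (V v) = v := DFunLike.congr_fun hV v
  set S : L →L[ℂ] L := (2 : ℂ) • V ∘L V† - 1 with hS
  have hSV : S ∘L V = V := by
    ext v
    simp [hS, hV', two_smul]
  have hSS : S ∘L S = 1 := by
    ext v
    simp [hS, hV', two_smul]
  have hSa : S† = S := by
    rw [← star_eq_adjoint, hS, star_sub, star_smul, star_one, star_eq_adjoint, adjoint_comp,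
      adjoint_adjoint]
    simp
  have hVS : V† ∘L S = V† := by
    conv_rhs => rw [← hSV, adjoint_comp, hSa]
  have hW : IsSelfAdjoint (S† ∘L Y ∘L S) := hY.adjoint_conj S
  have hWI : spectrum ℝ (S† ∘L Y ∘L S) ⊆ I :=
    spectrum_adjoint_conj_subset hI h0 hY hYI (by rw [hSa, hSS])
  have hWf : cfc f (S† ∘L Y ∘L S) = S ∘L cfc f Y ∘L S := by
    have := cfc_comp_eq_comp_cfc hI hf h0 (V := S) hY hW hYI hWI
      (by rw [hSa, comp_assoc, comp_assoc, hSS]; rfl)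
    conv_rhs => rw [← comp_assoc, ← this, comp_assoc, hSS]
    rfl
  have ht : (1 / 2 : ℝ) ∈ Set.Icc (0 : ℝ) 1 := by norm_num
  set Z : L →L[ℂ] L := (1 / 2 : ℝ) • Y + (1 - 1 / 2 : ℝ) • (S† ∘L Y ∘L S) with hZdef
  have hZ : IsSelfAdjoint Z :=
    ((IsSelfAdjoint.all _).smul hY).add ((IsSelfAdjoint.all _).smul hW)
  have hZI : spectrum ℝ Z ⊆ I := spectrum_convexCombination_subset hI h0 hY hW hYI hWI ht
  have hA : IsSelfAdjoint (V† ∘L Y ∘L V) := hY.adjoint_conj V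
  have hAI : spectrum ℝ (V† ∘L Y ∘L V) ⊆ I :=
    spectrum_adjoint_conj_subset hI h0 hY hYI hV.le
  have hSw (w : L) : S w = (2 : ℂ) • V ((V†) w) - w := by simp [hS]
  have hSV' (v : H) : S (V v) = V v := DFunLike.congr_fun hSV v
  have hVS' (v : L) : (V†) (S v) = (V†) v := DFunLike.congr_fun hVS v
  have hZV : Z ∘L V = V ∘L (V† ∘L Y ∘L V) := by
    ext v
    simp only [hZdef, hSa, add_apply, smul_apply, comp_apply, hSV']
    rw [hSw]
    module
  have hfZV := cfc_comp_eq_comp_cfc hI hf h0 hA hZ hAI hZI hZV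
  have hle := adjoint_conj_mono (hc L hL Y _ hY hW hYI hWI _ ht) V
  rw [← hZdef, hfZV, hWf, ← comp_assoc, hV] at hle
  refine hle.trans_eq ?_
  ext v
  simp only [add_apply, smul_apply, comp_apply, hSV', map_add, map_smul_of_tower, hVS']
  module

/-- Every nontrivial Hilbert space embeds isometrically into an infinite-dimensional one in
countably many pairwise orthogonal ways. -/
theorem exists_orthogonal_embeddings (H : Type) [NormedAddCommGroup H] [InnerProductSpace ℂ H]
    [CompleteSpace H] [Nontrivial H] :
    ∃ (L : Type) (_ : NormedAddCommGroup L) (_ : InnerProductSpace ℂ L) (_ : CompleteSpace L)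
      (J : ℕ → H →L[ℂ] L), ¬ FiniteDimensional ℂ L ∧
        ∀ j k v, ((J j)†) (J k v) = if j = k then v else 0 := by
  let J (k : ℕ) : H →L[ℂ] lp (fun _ : ℕ => H) 2 :=
    lp.singleContinuousLinearMap ℂ (fun _ : ℕ => H) 2 k
  have hJ (j k : ℕ) (w v : H) : ⟪J j w, J k v⟫_ℂ = ⟪w, if j = k then v else 0⟫_ℂ := by
    rw [lp.singleContinuousLinearMap_apply, lp.inner_single_left,
      lp.singleContinuousLinearMap_apply, lp.single_apply, Pi.single_apply]
  refine ⟨lp (fun _ : ℕ => H) 2, inferInstance, inferInstance, inferInstance, J, ?_, ?_⟩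
  · intro hfin
    obtain ⟨v, hv⟩ := exists_norm_eq H zero_le_one
    have ho : Orthonormal ℂ fun k => J k v := by
      rw [orthonormal_iff_ite]
      intro j k
      rw [hJ]
      split_ifs <;> simp [inner_self_eq_norm_sq_to_K, hv]
    exact not_finite_iff_infinite.2 inferInstance ho.linearIndependent.finite
  · intro j k v
    refine ext_inner_left ℂ fun w => ?_
    rw [adjoint_inner_right, hJ]

/-- The operator acting as `x k` on the range of `J k`, and as `0` off these ranges. -/
noncomputable def blockDiagonal (J : ℕ → H →L[ℂ] L) {n : ℕ} (x : Fin n → H →L[ℂ] H) : L →L[ℂ] L :=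
  ∑ k : Fin n, J k ∘L x k ∘L (J k)†

/-- The operator whose component in the range of `J k` is `a k`. -/
noncomputable def blockColumn (J : ℕ → H →L[ℂ] L) {n : ℕ} (a : Fin n → H →L[ℂ] H) : H →L[ℂ] L :=
  ∑ k : Fin n, J k ∘L a k

section Block

variable {J : ℕ → H →L[ℂ] L} {n : ℕ}

theorem sum_comp_adjoint_le_one (hJ : ∀ j k v, ((J j)†) (J k v) = if j = k then v else 0) :
    ∑ k : Fin n, J k ∘L (J k)† ≤ 1 := by
  set Q : L →L[ℂ] L := ∑ k : Fin n, J k ∘L (J k)† with hQ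
  have hstar : IsStarProjection Q := by
    constructor
    · ext v
      simp [hQ, hJ, Fin.val_inj, apply_ite]
    · exact isSelfAdjoint_sum _ fun k _ => by
        rw [isSelfAdjoint_iff', adjoint_comp, adjoint_adjoint]
  exact IsPositive.of_isStarProjection hstar.one_sub

theorem blockDiagonal_comp (hJ : ∀ j k v, ((J j)†) (J k v) = if j = k then v else 0)
    (x : Fin n → H →L[ℂ] H) (k : Fin n) : blockDiagonal J x ∘L J k = J k ∘L x k := by
  ext v
  simp [blockDiagonal, hJ, Fin.val_inj, apply_ite]

theorem blockDiagonal_eq_sum_adjoint_conj (x : Fin n → H →L[ℂ] H) :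
    blockDiagonal J x = ∑ k : Fin n, ((J k)†)† ∘L x k ∘L (J k)† := by
  simp only [blockDiagonal, adjoint_adjoint]

theorem isSelfAdjoint_blockDiagonal {x : Fin n → H →L[ℂ] H} (hx : ∀ k, IsSelfAdjoint (x k)) :
    IsSelfAdjoint (blockDiagonal J x) := by
  rw [blockDiagonal_eq_sum_adjoint_conj]
  exact isSelfAdjoint_sum_adjoint_conj (fun k : Fin n => (J k)†) hx

theorem spectrum_blockDiagonal_subset
    (hJ : ∀ j k v, ((J j)†) (J k v) = if j = k then v else 0)
    {I : Set ℝ} (hI : I.OrdConnected) (h0 : (0 : ℝ) ∈ I)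
    {x : Fin n → H →L[ℂ] H} (hx : ∀ k, IsSelfAdjoint (x k)) (hxI : ∀ k, spectrum ℝ (x k) ⊆ I) :
    spectrum ℝ (blockDiagonal J x) ⊆ I := by
  rw [blockDiagonal_eq_sum_adjoint_conj]
  refine spectrum_sum_adjoint_conj_subset hI h0 (a := fun k : Fin n => (J k)†) hx hxI ?_
  simpa only [adjoint_adjoint] using sum_comp_adjoint_le_one hJ

theorem cfc_blockDiagonal_comp (hJ : ∀ j k v, ((J j)†) (J k v) = if j = k then v else 0)
    {f : ℝ → ℝ} {I : Set ℝ} (hI : I.OrdConnected) (hf : ContinuousOn f I) (h0 : (0 : ℝ) ∈ I)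
    {x : Fin n → H →L[ℂ] H} (hx : ∀ k, IsSelfAdjoint (x k)) (hxI : ∀ k, spectrum ℝ (x k) ⊆ I)
    (k : Fin n) : cfc f (blockDiagonal J x) ∘L J k = J k ∘L cfc f (x k) :=
  cfc_comp_eq_comp_cfc hI hf h0 (hx k) (isSelfAdjoint_blockDiagonal hx) (hxI k)
    (spectrum_blockDiagonal_subset hJ hI h0 hx hxI) (blockDiagonal_comp hJ x k)

theorem adjoint_blockColumn_conj (hJ : ∀ j k v, ((J j)†) (J k v) = if j = k then v else 0)
    {T : L →L[ℂ] L} {t : Fin n → H →L[ℂ] H} (hT : ∀ k : Fin n, T ∘L J k = J k ∘L t k)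
    (a : Fin n → H →L[ℂ] H) :
    (blockColumn J a)† ∘L T ∘L blockColumn J a = ∑ k, (a k)† ∘L t k ∘L a k := by
  have hT' (k : Fin n) (v : H) : T (J k v) = J k (t k v) := DFunLike.congr_fun (hT k) v
  ext v
  simp [blockColumn, map_sum, adjoint_comp, hT', hJ, Fin.val_inj, apply_ite]

theorem adjoint_blockColumn_comp_self (hJ : ∀ j k v, ((J j)†) (J k v) = if j = k then v else 0)
    (a : Fin n → H →L[ℂ] H) :
    (blockColumn J a)† ∘L blockColumn J a = ∑ k, (a k)† ∘L a k :=
  adjoint_blockColumn_conj hJ (T := 1) (t := fun _ => 1) (fun _ => rfl) a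

end Block

/-- Jensen's operator inequality for unital columns. -/
theorem OperatorConvexOn.cfc_sum_adjoint_conj_le {H : Type} [NormedAddCommGroup H]
    [InnerProductSpace ℂ H] [CompleteSpace H] {f : ℝ → ℝ} {I : Set ℝ}
    (hc : OperatorConvexOn f I) (hI : I.OrdConnected) (hf : ContinuousOn f I) (h0 : (0 : ℝ) ∈ I)
    {n : ℕ} {x a : Fin n → H →L[ℂ] H} (hx : ∀ k, IsSelfAdjoint (x k))
    (hxI : ∀ k, spectrum ℝ (x k) ⊆ I) (ha : ∑ k, (a k)† ∘L a k = 1) :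
    cfc f (∑ k, (a k)† ∘L x k ∘L a k) ≤ ∑ k, (a k)† ∘L cfc f (x k) ∘L a k := by
  cases subsingleton_or_nontrivial H
  · exact (Subsingleton.elim _ _).le
  obtain ⟨L, _, _, _, J, hL, hJ⟩ := exists_orthogonal_embeddings H
  have := hc.cfc_adjoint_conj_le hI hf h0 hL (Y := blockDiagonal J x) (V := blockColumn J a)
    ((adjoint_blockColumn_comp_self hJ a).trans ha) (isSelfAdjoint_blockDiagonal hx)
    (spectrum_blockDiagonal_subset hJ hI h0 hx hxI)
  rwa [adjoint_blockColumn_conj hJ (blockDiagonal_comp hJ x),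
    adjoint_blockColumn_conj hJ (cfc_blockDiagonal_comp hJ hI hf h0 hx hxI)] at this

theorem OperatorConvexOn.jensenContractiveIneq {f : ℝ → ℝ} {I : Set ℝ}
    (hc : OperatorConvexOn f I) (hI : I.OrdConnected) (hf : ContinuousOn f I) (h0 : (0 : ℝ) ∈ I)
    (hf0 : f 0 ≤ 0) (n : ℕ) : JensenContractiveIneq f I n := by
  intro H _ _ _ x a hx hxI ha
  obtain ⟨c, hac⟩ := CStarAlgebra.nonneg_iff_eq_star_mul_self.1 (sub_nonneg.2 ha)
  have hcc : 0 ≤ c† ∘L c := (nonneg_iff_isPositive _).2 (isPositive_adjoint_comp_self c)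
  have h := hc.cfc_sum_adjoint_conj_le hI hf h0 (x := Fin.snoc x 0) (a := Fin.snoc a c)
    (fun k => by
      induction k using Fin.lastCases with
      | last => simp
      | cast k => simpa using hx k)
    (fun k => by
      induction k using Fin.lastCases with
      | last =>
        rw [Fin.snoc_last]
        cases subsingleton_or_nontrivial H
        · simp [spectrum.of_subsingleton]
        · simpa [spectrum.zero_eq] using h0
      | cast k => simpa using hxI k)
    (by
      simp only [Fin.sum_univ_castSucc, Fin.snoc_castSucc, Fin.snoc_last]
      exact (add_comm _ _).trans (eq_sub_iff_add_eq.1 hac.symm))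
  simp only [Fin.sum_univ_castSucc, Fin.snoc_castSucc, Fin.snoc_last, zero_comp, comp_zero,
    add_zero, cfc_apply_zero] at h
  refine le_trans h (add_le_of_nonpos_right ?_)
  have e : c† ∘L (algebraMap ℝ (H →L[ℂ] H) (f 0)) ∘L c = f 0 • c† ∘L c := by
    ext v
    simp [Algebra.algebraMap_eq_smul_one]
  rw [e]
  exact smul_nonpos_of_nonpos_of_nonneg hf0 hcc

/-- The contractive Jensen inequality for tuples of positive length implies the one for a single
operator. -/
theorem JensenContractiveIneq.cfc_adjoint_conj_le {H : Type} [NormedAddCommGroup H]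
    [InnerProductSpace ℂ H] [CompleteSpace H] {f : ℝ → ℝ} {I : Set ℝ} {n : ℕ} (hn : 0 < n)
    (h : JensenContractiveIneq f I n) {x a : H →L[ℂ] H} (hx : IsSelfAdjoint x)
    (hxI : spectrum ℝ x ⊆ I) (ha : a† ∘L a ≤ 1) :
    cfc f (a† ∘L x ∘L a) ≤ a† ∘L cfc f x ∘L a := by
  obtain ⟨n, rfl⟩ := Nat.exists_eq_add_one.2 hn
  have := h H (fun _ => x) (Fin.cons a 0) (fun _ => hx) (fun _ => hxI)
    (by simpa [Fin.sum_univ_succ, star_eq_adjoint, mul_def] using ha)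
  simpa [Fin.sum_univ_succ, star_eq_adjoint, mul_def, comp_assoc] using this

theorem JensenContractiveIneq.apply_zero_nonpos {f : ℝ → ℝ} {I : Set ℝ} {n : ℕ} (hn : 0 < n)
    (h : JensenContractiveIneq f I n) (h0 : (0 : ℝ) ∈ I) : f 0 ≤ 0 := by
  have := h.cfc_adjoint_conj_le hn (H := ℂ) (x := 0) (a := 0) (IsSelfAdjoint.zero _)
    (by simpa [spectrum.zero_eq] using h0) (by simp)
  simp only [comp_zero, cfc_apply_zero] at this
  have h2 : algebraMap ℝ (ℂ →L[ℂ] ℂ) (f 0) ≤ algebraMap ℝ (ℂ →L[ℂ] ℂ) 0 := by simpa using this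
  rw [algebraMap_le_iff_le_spectrum] at h2
  simpa [spectrum.zero_eq] using h2

theorem JensenContractiveIneq.operatorConvexOn {f : ℝ → ℝ} {I : Set ℝ} {n : ℕ} (hn : 0 < n)
    (h : JensenContractiveIneq f I n) (hI : I.OrdConnected) (hf : ContinuousOn f I)
    (h0 : (0 : ℝ) ∈ I) : OperatorConvexOn f I := by
  intro H _ _ _ hH x y hx hy hxI hyI t ht
  have : Nontrivial H := by
    by_contra hsub
    rw [not_nontrivial_iff_subsingleton] at hsub
    exact hH inferInstance
  obtain ⟨L, _, _, _, J, hL, hJ⟩ := exists_orthogonal_embeddings H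
  have hz : ∀ k, IsSelfAdjoint (![x, y] k) := by simp [Fin.forall_fin_two, hx, hy]
  have hzI : ∀ k, spectrum ℝ (![x, y] k) ⊆ I := by simp [Fin.forall_fin_two, hxI, hyI]
  set X : L →L[ℂ] L := blockDiagonal J ![x, y]
  have hX : IsSelfAdjoint X := isSelfAdjoint_blockDiagonal hz
  have hXI : spectrum ℝ X ⊆ I := spectrum_blockDiagonal_subset hJ hI h0 hz hzI
  set C : H →L[ℂ] L :=
    blockColumn J ![(√t : ℂ) • (1 : H →L[ℂ] H), (√(1 - t) : ℂ) • (1 : H →L[ℂ] H)] with hC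
  have hsq {s : ℝ} (hs : 0 ≤ s) (v : H) : √s • √s • v = s • v := by
    rw [smul_smul, Real.mul_self_sqrt hs]
  have hconj {T : L →L[ℂ] L} {r : Fin 2 → H →L[ℂ] H}
      (hT : ∀ k : Fin 2, T ∘L J k = J k ∘L r k) :
      C† ∘L T ∘L C = t • r 0 + (1 - t) • r 1 := by
    rw [hC, adjoint_blockColumn_conj hJ hT]
    ext v
    simp [Fin.sum_univ_two, ← star_eq_adjoint, hsq ht.1, hsq (sub_nonneg.2 ht.2)]
  have hCC : C† ∘L C = 1 := by
    have := hconj (T := 1) (r := fun _ => 1) (fun _ => rfl)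
    rw [← add_smul, add_sub_cancel, one_smul] at this
    exact this
  have hJ0 : (J 0)† ∘L J 0 = 1 := by
    ext v
    simp [hJ]
  set A : L →L[ℂ] L := C ∘L (J 0)† with hA
  have hconjA (T : L →L[ℂ] L) : A† ∘L T ∘L A = J 0 ∘L (C† ∘L T ∘L C) ∘L (J 0)† := by
    rw [hA, adjoint_comp, adjoint_adjoint]
    rfl
  have hAA : A† ∘L A ≤ 1 := by
    have h1 : A† ∘L A = J 0 ∘L (J 0)† := by
      have := hconjA 1
      rw [show C† ∘L 1 ∘L C = 1 from hCC] at this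
      exact this
    rw [h1]
    simpa using sum_comp_adjoint_le_one (n := 1) hJ
  have hXA : C† ∘L X ∘L C = t • x + (1 - t) • y := hconj (blockDiagonal_comp hJ _)
  have hfXA : C† ∘L cfc f X ∘L C = t • cfc f x + (1 - t) • cfc f y :=
    hconj (cfc_blockDiagonal_comp hJ hI hf h0 hz hzI)
  have hint := cfc_comp_eq_comp_cfc hI hf h0 (x := t • x + (1 - t) • y) (X := A† ∘L X ∘L A)
    (V := J 0) (((IsSelfAdjoint.all t).smul hx).add ((IsSelfAdjoint.all (1 - t)).smul hy))
    (hX.adjoint_conj A) (spectrum_convexCombination_subset hI h0 hx hy hxI hyI ht)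
    (spectrum_adjoint_conj_subset hI h0 hX hXI hAA)
    (by rw [hconjA, hXA, comp_assoc, comp_assoc, hJ0]; rfl)
  have hle := adjoint_conj_mono (h.cfc_adjoint_conj_le hn hX hXI hAA) (J 0)
  rw [hint, hconjA, hfXA, ← comp_assoc, hJ0] at hle
  refine hle.trans_eq ?_
  rw [comp_assoc, comp_assoc, hJ0, ← comp_assoc, hJ0]
  rfl

end Jensen

/-- **Jensen's operator inequality, contractive version (Corollary 2.3).**  Let `f` be
continuous on an interval `I ⊆ ℝ` with `0 ∈ I`.  Then `f` is operator convex on `I` with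
`f(0) ≤ 0` if and only if for some — equivalently, every — natural number `n ≥ 1`, Jensen's
inequality holds for all contractive `n`-tuples, i.e. `f(∑ aₖ* xₖ aₖ) ≤ ∑ aₖ* f(xₖ) aₖ`
whenever the `xₖ` are self-adjoint with spectra in `I` and `∑ aₖ* aₖ ≤ 1`. -/
theorem jensen_operator_inequality_contractive
    (f : ℝ → ℝ) (I : Set ℝ) (hI : I.OrdConnected) (hf : ContinuousOn f I)
    (h0 : (0 : ℝ) ∈ I) :
    ((OperatorConvexOn f I ∧ f 0 ≤ 0) ↔ ∃ n : ℕ, 0 < n ∧ JensenContractiveIneq f I n) ∧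
    ((OperatorConvexOn f I ∧ f 0 ≤ 0) ↔ ∀ n : ℕ, 0 < n → JensenContractiveIneq f I n) := by
  have forward (h : OperatorConvexOn f I ∧ f 0 ≤ 0) (n : ℕ) : JensenContractiveIneq f I n :=
    h.1.jensenContractiveIneq hI hf h0 h.2 n
  have backward {n : ℕ} (hn : 0 < n) (h : JensenContractiveIneq f I n) :
      OperatorConvexOn f I ∧ f 0 ≤ 0 :=
    ⟨h.operatorConvexOn hn hI hf h0, h.apply_zero_nonpos hn h0⟩
  exact ⟨⟨fun h => ⟨1, one_pos, forward h 1⟩, fun ⟨n, hn, h⟩ => backward hn h⟩,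
    fun h n _ => forward h n, fun h => backward one_pos (h 1 one_pos)⟩
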